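/- If p : X × X → ℝ is a complete bounded pseudometric on X, then sj(p) is a complete pseudometric on X × X × [0,1]: every sequence (u_n) in X × X × [0,1] that is Cauchy with respect to sj(p) (for every ε > 0 there is N such that sj(p)(u_n,u_m) < ε for all n, m ≥ N) admits a point u ∈ X × X × [0,1] with sj(p)(u_n,u) → 0. -/

import Mathlib

open Filter Topology

/-- The squeezed-join operator given by the great magic formula. -/
noncomputable def sj {X : Type*} (p : X × X → ℝ) :
    (X × X × unitInterval) × (X × X × unitInterval) → ℝ :=
  fun w =>
    min (1 - (w.1.2.2 : ℝ)) (1 - (w.2.2.2 : ℝ)) * p (w.1.1, w.2.1) +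
    max 0 ((w.2.2.2 : ℝ) - (w.1.2.2 : ℝ)) * p (w.1.1, w.2.2.1) +
    max 0 ((w.1.2.2 : ℝ) - (w.2.2.2 : ℝ)) * p (w.1.2.1, w.2.1) +
    min ((w.1.2.2 : ℝ)) ((w.2.2.2 : ℝ)) * p (w.1.2.1, w.2.2.1)

/-- `p : Z × Z → ℝ` is a pseudometric. -/
def IsPseudometric {Z : Type*} (p : Z × Z → ℝ) : Prop :=
  (∀ x y : Z, 0 ≤ p (x, y)) ∧ (∀ x : Z, p (x, x) = 0) ∧
  (∀ x y : Z, p (x, y) = p (y, x)) ∧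
  (∀ x y z : Z, p (x, z) ≤ p (x, y) + p (y, z))

namespace IsPseudometric

variable {X : Type*} {p : X × X → ℝ}

theorem sj_nonneg (hp : IsPseudometric p) (u v : X × X × unitInterval) : 0 ≤ sj p (u, v) := by
  obtain ⟨x, y, t, ht0, ht1⟩ := u
  obtain ⟨x', y', t', ht0', ht1'⟩ := v
  have hnn := hp.1
  have h₁ : 0 ≤ min (1 - t) (1 - t') := le_min (by linarith) (by linarith)
  have h₂ : 0 ≤ min t t' := le_min ht0 ht0'
  have h₃ : 0 ≤ max 0 (t' - t) := le_max_left _ _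
  have h₄ : 0 ≤ max 0 (t - t') := le_max_left _ _
  have := mul_nonneg h₁ (hnn x x')
  have := mul_nonneg h₂ (hnn y y')
  have := mul_nonneg h₃ (hnn x y')
  have := mul_nonneg h₄ (hnn y x')
  simp only [sj]
  linarith

theorem sj_self (hp : IsPseudometric p) (u : X × X × unitInterval) : sj p (u, u) = 0 := by
  simp [sj, hp.2.1]

theorem sj_comm (hp : IsPseudometric p) (u v : X × X × unitInterval) :
    sj p (u, v) = sj p (v, u) := by
  simp only [sj, hp.2.2.1 v.1, hp.2.2.1 v.2.1, min_comm (v.2.2 : ℝ),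
    min_comm (1 - (v.2.2 : ℝ))]
  ring

theorem sj_triangle (hp : IsPseudometric p) (u v w : X × X × unitInterval) :
    sj p (u, w) ≤ sj p (u, v) + sj p (v, w) := by
  obtain ⟨x, y, r, hr0, hr1⟩ := u
  obtain ⟨x', y', s, hs0, hs1⟩ := v
  obtain ⟨x'', y'', t, ht0, ht1⟩ := w
  have tri {a b c : X} {k : ℝ} (hk : 0 ≤ k) : k * p (a, c) ≤ k * p (a, b) + k * p (b, c) := by
    rw [← mul_add]
    exact mul_le_mul_of_nonneg_left (hp.2.2.2 a b c) hk
  simp only [sj]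
  rcases le_total r s with hrs | hrs <;> rcases le_total s t with hst | hst <;>
    rcases le_total r t with hrt | hrt <;>
    simp only [hrs, hst, hrt, sub_le_sub_left, sub_nonneg, sub_nonpos, min_eq_left, min_eq_right,
      max_eq_left, max_eq_right]
  · linarith [tri (a := x) (b := x') (c := x'') (sub_nonneg.2 ht1),
      tri (a := x) (b := x') (c := y'') (sub_nonneg.2 hst),
      tri (a := x) (b := y') (c := y'') (sub_nonneg.2 hrs),
      tri (a := y) (b := y') (c := y'') hr0]
  · obtain rfl : r = s := by linarith
    obtain rfl : r = t := by linarith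
    linarith [tri (a := x) (b := x') (c := x'') (sub_nonneg.2 hr1),
      tri (a := y) (b := y') (c := y'') hr0]
  · linarith [tri (a := x) (b := x') (c := x'') (sub_nonneg.2 hs1),
      tri (a := x) (b := y') (c := x'') (sub_nonneg.2 hst),
      tri (a := x) (b := y') (c := y'') (sub_nonneg.2 hrt),
      tri (a := y) (b := y') (c := y'') hr0]
  · linarith [tri (a := x) (b := x') (c := x'') (sub_nonneg.2 hs1),
      tri (a := x) (b := y') (c := x'') (sub_nonneg.2 hrs),
      tri (a := y) (b := y') (c := x'') (sub_nonneg.2 hrt),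
      tri (a := y) (b := y') (c := y'') ht0]
  · linarith [tri (a := x) (b := x') (c := x'') (sub_nonneg.2 ht1),
      tri (a := x) (b := x') (c := y'') (sub_nonneg.2 hrt),
      tri (a := y) (b := x') (c := y'') (sub_nonneg.2 hrs),
      tri (a := y) (b := y') (c := y'') hs0]
  · linarith [tri (a := x) (b := x') (c := x'') (sub_nonneg.2 hr1),
      tri (a := y) (b := x') (c := x'') (sub_nonneg.2 hrt),
      tri (a := y) (b := x') (c := y'') (sub_nonneg.2 hst),
      tri (a := y) (b := y') (c := y'') hs0]
  · obtain rfl : r = s := by linarith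
    obtain rfl : r = t := by linarith
    linarith [tri (a := x) (b := x') (c := x'') (sub_nonneg.2 hr1),
      tri (a := y) (b := y') (c := y'') hr0]
  · linarith [tri (a := x) (b := x') (c := x'') (sub_nonneg.2 hr1),
      tri (a := y) (b := x') (c := x'') (sub_nonneg.2 hrs),
      tri (a := y) (b := y') (c := x'') (sub_nonneg.2 hst),
      tri (a := y) (b := y') (c := y'') ht0]

/-- The squeezed join of a pseudometric is a pseudometric. -/
protected theorem sj (hp : IsPseudometric p) : IsPseudometric (sj p) :=
  ⟨hp.sj_nonneg, hp.sj_self, hp.sj_comm, hp.sj_triangle⟩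

theorem min_one_sub_mul_le_sj (hp : IsPseudometric p) (u v : X × X × unitInterval) :
    min (1 - (u.2.2 : ℝ)) (1 - (v.2.2 : ℝ)) * p (u.1, v.1) ≤ sj p (u, v) := by
  have := mul_nonneg (le_max_left 0 ((v.2.2 : ℝ) - u.2.2)) (hp.1 u.1 v.2.1)
  have := mul_nonneg (le_max_left 0 ((u.2.2 : ℝ) - v.2.2)) (hp.1 u.2.1 v.1)
  have := mul_nonneg (le_min u.2.2.2.1 v.2.2.2.1) (hp.1 u.2.1 v.2.1)
  simp only [sj]
  linarith

theorem min_mul_le_sj (hp : IsPseudometric p) (u v : X × X × unitInterval) :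
    min (u.2.2 : ℝ) (v.2.2 : ℝ) * p (u.2.1, v.2.1) ≤ sj p (u, v) := by
  have := mul_nonneg (le_max_left 0 ((v.2.2 : ℝ) - u.2.2)) (hp.1 u.1 v.2.1)
  have := mul_nonneg (le_max_left 0 ((u.2.2 : ℝ) - v.2.2)) (hp.1 u.2.1 v.1)
  have := mul_nonneg (le_min (sub_nonneg.2 u.2.2.2.2) (sub_nonneg.2 v.2.2.2.2)) (hp.1 u.1 v.1)
  simp only [sj]
  linarith

theorem sj_le (hp : IsPseudometric p) {M : ℝ} (hb : ∀ x y, |p (x, y)| ≤ M)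
    (u v : X × X × unitInterval) :
    sj p (u, v) ≤ (1 - (v.2.2 : ℝ)) * p (u.1, v.1) + |(u.2.2 : ℝ) - v.2.2| * M +
      v.2.2 * p (u.2.1, v.2.1) := by
  have hM x y : p (x, y) ≤ M := (le_abs_self _).trans (hb x y)
  have h₁ := mul_le_mul_of_nonneg_right (min_le_right (1 - (u.2.2 : ℝ)) (1 - (v.2.2 : ℝ)))
    (hp.1 u.1 v.1)
  have h₂ := mul_le_mul_of_nonneg_right (min_le_right (u.2.2 : ℝ) (v.2.2 : ℝ))
    (hp.1 u.2.1 v.2.1)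
  have h₃ := mul_le_mul_of_nonneg_left (hM u.1 v.2.1) (le_max_left 0 ((v.2.2 : ℝ) - u.2.2))
  have h₄ := mul_le_mul_of_nonneg_left (hM u.2.1 v.1) (le_max_left 0 ((u.2.2 : ℝ) - v.2.2))
  have h₅ : |(u.2.2 : ℝ) - v.2.2| =
      max 0 ((v.2.2 : ℝ) - u.2.2) + max 0 ((u.2.2 : ℝ) - v.2.2) := by
    rcases le_total (u.2.2 : ℝ) v.2.2 with h | h
    · simp [abs_of_nonpos, h]
    · simp [abs_of_nonneg, h]
  rw [h₅, add_mul]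
  simp only [sj]
  linarith

/-- A sequence that is Cauchy up to weights `c n → a` converges up to the weight `a`. -/
theorem exists_tendsto_const_mul (hp : IsPseudometric p)
    (hcomp : ∀ x : ℕ → X,
      (∀ ε : ℝ, 0 < ε → ∃ N : ℕ, ∀ n ≥ N, ∀ m ≥ N, p (x n, x m) < ε) →
      ∃ x₀ : X, Tendsto (fun n => p (x n, x₀)) atTop (𝓝 0))
    {c : ℕ → ℝ} {a : ℝ} (ha : 0 ≤ a) (hc : Tendsto c atTop (𝓝 a)) (x : ℕ → X)
    (hx : ∀ ε : ℝ, 0 < ε → ∃ N : ℕ, ∀ n ≥ N, ∀ m ≥ N, min (c n) (c m) * p (x n, x m) < ε) :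
    ∃ x₀ : X, Tendsto (fun n => a * p (x n, x₀)) atTop (𝓝 0) := by
  rcases ha.eq_or_lt with rfl | ha
  · exact ⟨x 0, by simp⟩
  obtain ⟨x₀, hx₀⟩ := hcomp x fun ε hε => by
    obtain ⟨N₁, hN₁⟩ := eventually_atTop.1 (hc.eventually_const_lt (half_lt_self ha))
    obtain ⟨N₂, hN₂⟩ := hx (a / 2 * ε) (by positivity)
    refine ⟨max N₁ N₂, fun n hn m hm => ?_⟩
    have h := hN₂ n (le_of_max_le_right hn) m (le_of_max_le_right hm)
    have hmin := lt_min (hN₁ n (le_of_max_le_left hn)) (hN₁ m (le_of_max_le_left hm))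
    have := mul_le_mul_of_nonneg_right hmin.le (hp.1 (x n) (x m))
    exact lt_of_mul_lt_mul_left (this.trans_lt h) (by positivity)
  exact ⟨x₀, by simpa using hx₀.const_mul a⟩

theorem tendsto_of_cauchy_of_subseq {Z : Type*} {d : Z × Z → ℝ} (hd : IsPseudometric d)
    {u : ℕ → Z} (hu : ∀ ε : ℝ, 0 < ε → ∃ N : ℕ, ∀ n ≥ N, ∀ m ≥ N, d (u n, u m) < ε)
    {φ : ℕ → ℕ} (hφ : StrictMono φ) {z : Z}
    (hz : Tendsto (fun n => d (u (φ n), z)) atTop (𝓝 0)) :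
    Tendsto (fun n => d (u n, z)) atTop (𝓝 0) := by
  have h : Tendsto (fun n => d (u n, u (φ n))) atTop (𝓝 0) := by
    refine Metric.tendsto_atTop.2 fun ε hε => ?_
    obtain ⟨N, hN⟩ := hu ε hε
    refine ⟨N, fun n hn => ?_⟩
    rw [Real.dist_0_eq_abs, abs_of_nonneg (hd.1 _ _)]
    exact hN n hn _ (hn.trans (hφ.le_apply))
  exact squeeze_zero (fun n => hd.1 _ _) (fun n => hd.2.2.2 _ (u (φ n)) _)
    (by simpa using h.add hz)

end IsPseudometric

/-- `sj` sends complete bounded pseudometrics to complete pseudometrics. -/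
theorem sj_complete {X : Type*} (p : X × X → ℝ) (hp : IsPseudometric p)
    (M : ℝ) (hb : ∀ x y : X, |p (x, y)| ≤ M)
    (hcomp : ∀ x : ℕ → X,
      (∀ ε : ℝ, 0 < ε → ∃ N : ℕ, ∀ n ≥ N, ∀ m ≥ N, p (x n, x m) < ε) →
      ∃ x₀ : X, Tendsto (fun n => p (x n, x₀)) atTop (nhds 0)) :
    IsPseudometric (sj p) ∧
    ∀ u : ℕ → X × X × unitInterval,
      (∀ ε : ℝ, 0 < ε → ∃ N : ℕ, ∀ n ≥ N, ∀ m ≥ N, sj p (u n, u m) < ε) →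
      ∃ u₀ : X × X × unitInterval,
        Tendsto (fun n => sj p (u n, u₀)) atTop (nhds 0) := by
  refine ⟨hp.sj, fun u hu => ?_⟩
  obtain ⟨t, φ, hφ, ht⟩ := CompactSpace.tendsto_subseq fun n => (u n).2.2
  have ht' : Tendsto (fun n => ((u (φ n)).2.2 : ℝ)) atTop (𝓝 t) :=
    (continuous_subtype_val.tendsto t).comp ht
  have huφ : ∀ ε : ℝ, 0 < ε → ∃ N : ℕ, ∀ n ≥ N, ∀ m ≥ N, sj p (u (φ n), u (φ m)) < ε :=
    fun ε hε => (hu ε hε).imp fun N hN n hn m hm =>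
      hN _ (hn.trans hφ.le_apply) _ (hm.trans hφ.le_apply)
  obtain ⟨x, hx⟩ := hp.exists_tendsto_const_mul hcomp (sub_nonneg.2 t.2.2) (ht'.const_sub 1)
    (fun n => (u (φ n)).1) fun ε hε => (huφ ε hε).imp fun N hN n hn m hm =>
      (hp.min_one_sub_mul_le_sj _ _).trans_lt (hN n hn m hm)
  obtain ⟨y, hy⟩ := hp.exists_tendsto_const_mul hcomp t.2.1 ht'
    (fun n => (u (φ n)).2.1) fun ε hε => (huφ ε hε).imp fun N hN n hn m hm =>
      (hp.min_mul_le_sj _ _).trans_lt (hN n hn m hm)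
  have habs : Tendsto (fun n => |((u (φ n)).2.2 : ℝ) - t| * M) atTop (𝓝 0) := by
    simpa using (ht'.sub_const (t : ℝ)).abs.mul_const M
  refine ⟨(x, y, t), hp.sj.tendsto_of_cauchy_of_subseq hu hφ ?_⟩
  exact squeeze_zero (fun n => hp.sj_nonneg _ _) (fun n => hp.sj_le hb _ (x, y, t))
    (by simpa using (hx.add habs).add hy)
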